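/- For every integer n ≥ 1 and every integer k, the number of Stirling permutations of the second kind of order n having exactly k cycle plateaus equals the number of Stirling permutations of order n having exactly k descents; equivalently, C_n(x) = Σ_{π ∈ Q_n^2} x^{cplat(π)} as polynomials in x. -/

import Mathlib

open scoped Classical
noncomputable section

/-- The multiset `{1,1,2,2,…,n,n}` as a list. -/
def baseList (n : ℕ) : List ℕ := (List.range n).flatMap (fun i => [i + 1, i + 1])

/-- A word is Stirling if whenever the same value occurs at positions `i < k`,
every entry strictly between them is greater than that value. -/
def IsStirlingWord (l : List ℕ) : Prop :=
  ∀ i j k : Fin l.length, i < j → j < k → l.get i = l.get k → l.get i < l.get j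

/-- The set `Q_n` of Stirling permutations of order `n`:  rearrangements of the
multiset `{1,1,2,2,…,n,n}` in which all entries between the two occurrences of any
value exceed that value. -/
def stirlingPerms (n : ℕ) : Finset (List ℕ) :=
  ((baseList n).permutations.toFinset).filter IsStirlingWord

/-- Number of descents of `σ ∈ Q_n`: indices `i ∈ {1,…,2n}` (here 0-based) with
`σ_i > σ_{i+1}`, with the convention `σ_{2n+1} = 0`. -/
def desList (l : List ℕ) : ℕ :=
  ((Finset.range l.length).filter (fun i => l.getD (i + 1) 0 < l.getD i 0)).card

/-- The second-order Eulerian polynomial `C_n(x) = ∑_{σ ∈ Q_n} x^{des σ}`. -/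
def Cpoly (n : ℕ) : Polynomial ℚ :=
  ∑ σ ∈ stirlingPerms n, Polynomial.X ^ desList σ

/-- A list of cycles is a valid standard cycle form of a Stirling permutation of the
second kind of order `n` if:  the cycles are disjoint and together use each of
`1,1,2,2,…,n,n` exactly once; both copies of any value lie in the same cycle; each
cycle starts with (one of) its smallest entries; the cycles are listed in increasing
order of their smallest (first) entries; and the word of each cycle reduces to a
Stirling permutation. -/
def IsStirling2 (n : ℕ) (c : List (List ℕ)) : Prop :=
  c.flatten.Perm (baseList n) ∧
  (∀ w ∈ c, w ≠ [] ∧ (∀ v ∈ w, w.count v = 2) ∧ (∀ v ∈ w, w.headI ≤ v) ∧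
      IsStirlingWord w) ∧
  c.Chain' (fun w₁ w₂ => w₁.headI < w₂.headI)

/-- The set `Q_n²` of Stirling permutations of the second kind of order `n`,
each recorded as its standard cycle form (a list of cycles). -/
def stirling2 (n : ℕ) : Finset (List (List ℕ)) :=
  ((((baseList n).permutations.toFinset) ×ˢ (Finset.univ : Finset (Composition (2 * n)))).image
      (fun p => p.1.splitWrtComposition p.2)).filter (IsStirling2 n)

/-- `cyc(σ)`: the number of cycles. -/
def cyc (c : List (List ℕ)) : ℕ := c.length

/-- `cplat(σ)`: the number of cycle plateaus, i.e. entries `c_i` of a cycle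
`(c_1,…,c_{2k})` with `c_i = c_{i+1}`, `1 ≤ i < 2k`. -/
def cplat (c : List (List ℕ)) : ℕ :=
  (c.map (fun w => ((Finset.range w.length).filter
    (fun i => i + 1 < w.length ∧ w.getD i 0 = w.getD (i + 1) 0)).card)).sum

/-- `casc(σ)`: the number of cycle ascents, i.e. entries `c_i` of a cycle
`(c_1,…,c_{2k})` with `c_i < c_{i+1}`, `1 ≤ i < 2k`. -/
def casc (c : List (List ℕ)) : ℕ :=
  (c.map (fun w => ((Finset.range w.length).filter
    (fun i => i + 1 < w.length ∧ w.getD i 0 < w.getD (i + 1) 0)).card)).sum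

/-- `cap(σ)`: the number of cycle ascent plateaus, i.e. entries `c_i` of a cycle
`(c_1,…,c_{2k})` with `c_{i-1} < c_i = c_{i+1}`, `2 ≤ i ≤ 2k-1`. -/
def capSt (c : List (List ℕ)) : ℕ :=
  (c.map (fun w => ((Finset.range w.length).filter
    (fun i => 0 < i ∧ i + 1 < w.length ∧
      w.getD (i - 1) 0 < w.getD i 0 ∧ w.getD i 0 = w.getD (i + 1) 0)).card)).sum

/-- `fix(σ)`: the number of fixed points, i.e. values `k` with `(k,k)` a cycle of `σ`. -/
def fixSt (c : List (List ℕ)) : ℕ :=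
  ((Finset.range c.length).filter (fun i => ∃ k : ℕ, c.getD i [] = [k, k])).card

/-- Membership in `stirlingPerms`, free of the enumeration. -/
theorem mem_stirlingPerms {n : ℕ} {l : List ℕ} :
    l ∈ stirlingPerms n ↔ l.Perm (baseList n) ∧ IsStirlingWord l := by
  simp [stirlingPerms]

theorem baseList_succ (n : ℕ) : baseList (n + 1) = baseList n ++ [n + 1, n + 1] := by
  simp [baseList, List.range_succ]

theorem length_baseList (n : ℕ) : (baseList n).length = 2 * n := by
  induction n with
  | zero => rfl
  | succ n ih => simp [baseList_succ, ih]; ring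

theorem lt_of_mem_baseList {n v : ℕ} (h : v ∈ baseList n) : v < n + 1 := by
  simp only [baseList, List.mem_flatMap, List.mem_range, List.mem_cons, List.not_mem_nil,
    or_false, or_self] at h
  omega

theorem mem_stirling2 {n : ℕ} {c : List (List ℕ)} : c ∈ stirling2 n ↔ IsStirling2 n c := by
  simp only [stirling2, Finset.mem_filter, Finset.mem_image, Finset.mem_product,
    List.mem_toFinset, List.mem_permutations, Finset.mem_univ, and_true, Prod.exists,
    and_iff_right_iff_imp]
  intro h
  have hlen : c.flatten.length = 2 * n := by rw [h.1.length_eq, length_baseList]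
  generalize 2 * n = N at hlen
  subst hlen
  refine ⟨c.flatten, ⟨c.map List.length, ?_, ?_⟩, h.1, ?_⟩
  · intro i hi
    obtain ⟨w, hw, rfl⟩ := List.mem_map.1 hi
    exact List.length_pos_iff.2 (h.2.1 w hw).1
  · simp [List.length_flatten]
  · exact List.splitWrtComposition_flatten _ _ rfl

/-! ### Stirling words and the insertion of a pair of maximal letters -/

theorem isStirlingWord_iff_sublist {l : List ℕ} :
    IsStirlingWord l ↔ ∀ x y, List.Sublist [x, y, x] l → x < y := by
  constructor
  · intro h x y hs
    obtain ⟨f, hf⟩ := List.sublist_iff_exists_fin_orderEmbedding_get_eq.1 hs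
    have h0 := hf 0
    have h1 := hf 1
    have h2 := hf 2
    have := h (f 0) (f 1) (f 2) (f.strictMono (by simp))
      (f.strictMono (by simp [Fin.lt_def])) (h0.symm.trans h2)
    rw [← h0, ← h1] at this
    exact this
  · intro h i j k hij hjk he
    refine h _ _ (List.sublist_iff_exists_fin_orderEmbedding_get_eq.2
      ⟨OrderEmbedding.ofStrictMono ![i, j, k] ?_, ?_⟩)
    · refine Fin.strictMono_iff_lt_succ.2 fun a => ?_
      fin_cases a
      · exact hij
      · exact hjk
    · intro a
      fin_cases a
      · rfl
      · rfl
      · exact he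

theorem IsStirlingWord.sublist {l l' : List ℕ} (h : IsStirlingWord l) (hs : l'.Sublist l) :
    IsStirlingWord l' := by
  rw [isStirlingWord_iff_sublist] at h ⊢
  exact fun x y hxy => h x y (hxy.trans hs)

theorem isStirlingWord_insert_iff {a b : List ℕ} {m : ℕ} (ha : ∀ v ∈ a, v < m)
    (hb : ∀ v ∈ b, v < m) : IsStirlingWord (a ++ m :: m :: b) ↔ IsStirlingWord (a ++ b) := by
  have hma : m ∉ a := fun h => (ha m h).false
  have hmb : m ∉ b := fun h => (hb m h).false
  constructor
  · exact fun h => h.sublist (List.Sublist.append_left (by simp) a)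
  · intro h
    rw [isStirlingWord_iff_sublist] at h ⊢
    intro x y hs
    have hmem : ∀ z ∈ [x, y, x], z ≠ m → z < m := by
      intro z hz hzm
      have := hs.subset hz
      simp only [List.mem_append, List.mem_cons, hzm, false_or] at this
      exact this.elim (ha z) (hb z)
    by_cases hx : x = m
    · subst hx
      exfalso
      have hs' : List.Sublist [x, y, x] (x :: x :: b) := by
        rw [List.sublist_append_iff] at hs
        obtain ⟨l₁, l₂, he, h₁, h₂⟩ := hs
        cases l₁ with
        | nil => rw [List.nil_append] at he; rwa [he]
        | cons z t =>
          rw [List.cons_append, List.cons.injEq] at he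
          exact absurd (h₁.subset (he.1 ▸ List.mem_cons_self)) hma
      have h2 := List.cons_sublist_cons.1 hs'
      by_cases hy : y = x
      · subst hy
        have := List.cons_sublist_cons.1 h2
        exact hmb (this.subset List.mem_cons_self)
      · have : List.Sublist [y, x] b := by
          cases h2 with
          | cons _ h => exact h
          | cons_cons _ h => exact absurd rfl hy
        exact hmb (this.subset (by simp))
    · by_cases hy : y = m
      · rw [hy]; exact hmem x (by simp) hx
      · have := hs.filter (fun z => z != m)
        have e1 : a.filter (fun z => z != m) = a :=
          List.filter_eq_self.2 fun z hz => by simpa using (ha z hz).ne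
        have e2 : (m :: m :: b).filter (fun z => z != m) = b := by
          rw [List.filter_cons_of_neg (by simp), List.filter_cons_of_neg (by simp)]
          exact List.filter_eq_self.2 fun z hz => by simpa using (hb z hz).ne
        rw [List.filter_append, e1, e2] at this
        refine h x y ?_
        simpa [hx, hy] using this

/-- In a Stirling word the two copies of the maximal letter are adjacent. -/
theorem IsStirlingWord.exists_eq_insert {l : List ℕ} {m : ℕ} (h : IsStirlingWord l)
    (hc : l.count m = 2) (hl : ∀ v ∈ l, v ≤ m) :
    ∃ a b, l = a ++ m :: m :: b ∧ (∀ v ∈ a, v < m) ∧ ∀ v ∈ b, v < m := by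
  have hm : m ∈ l := List.count_pos_iff.1 (by omega)
  obtain ⟨a, t, rfl, hma⟩ := List.eq_append_cons_of_mem hm
  have hct : t.count m = 1 := by
    rw [List.count_append, List.count_eq_zero.2 hma, List.count_cons_self] at hc
    omega
  obtain ⟨s, b, rfl, hms⟩ := List.eq_append_cons_of_mem (List.count_pos_iff.1 (hct ▸ one_pos))
  have hmb : m ∉ b := by
    rw [List.count_append, List.count_cons_self] at hct
    exact List.count_eq_zero.1 (by omega)
  cases s with
  | nil =>
    refine ⟨a, b, rfl, fun v hv => ?_, fun v hv => ?_⟩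
    · exact lt_of_le_of_ne (hl v (by simp [hv])) fun e => hma (e ▸ hv)
    · exact lt_of_le_of_ne (hl v (by simp [hv])) fun e => hmb (e ▸ hv)
  | cons y s =>
    have := isStirlingWord_iff_sublist.1 h m y
      ((List.Sublist.cons_cons m (List.Sublist.cons_cons y (by simp))).trans
        (List.sublist_append_right a _))
    have := hl y (by simp)
    omega

/-- Insert two adjacent copies of `m` after the first `i` letters of `l`. -/
def insertPair (m i : ℕ) (l : List ℕ) : List ℕ := l.take i ++ m :: m :: l.drop i

@[simp]
theorem insertPair_zero (m : ℕ) (l : List ℕ) : insertPair m 0 l = m :: m :: l := rfl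

@[simp]
theorem insertPair_succ_cons (m i x : ℕ) (l : List ℕ) :
    insertPair m (i + 1) (x :: l) = x :: insertPair m i l := rfl

theorem insertPair_append (m : ℕ) (a b : List ℕ) :
    insertPair m a.length (a ++ b) = a ++ m :: m :: b := by
  simp [insertPair]

theorem mem_insertPair_self (m i : ℕ) (l : List ℕ) : m ∈ insertPair m i l := by
  simp [insertPair]

theorem filter_insertPair {m : ℕ} {l : List ℕ} (h : m ∉ l) (i : ℕ) :
    (insertPair m i l).filter (fun z => z != m) = l := by
  rw [insertPair, List.filter_append, List.filter_cons_of_neg (by simp),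
    List.filter_cons_of_neg (by simp), ← List.filter_append, List.take_append_drop]
  exact List.filter_eq_self.2 fun z hz => by simpa using fun e : z = m => h (e ▸ hz)

theorem insertPair_left_inj {m i j : ℕ} {l : List ℕ} (h : m ∉ l) (hi : i ≤ l.length)
    (hj : j ≤ l.length) (e : insertPair m i l = insertPair m j l) : i = j := by
  have key : ∀ k ≤ l.length, (insertPair m k l).idxOf m = k := by
    intro k hk
    rw [insertPair, List.idxOf_append_of_notMem fun h' => h (List.mem_of_mem_take h')]
    simp [hk]
  rw [← key i hi, e, key j hj]

/-! ### Statistics counting pairs of adjacent letters -/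

/-- The number of positions of `l` whose letter `x` and successor `o` (`none` at the end)
satisfy `P x o`. -/
def adjStat (P : ℕ → Option ℕ → Prop) (l : List ℕ) : ℕ :=
  ((Finset.range l.length).filter fun i => P (l.getD i 0) l[i + 1]?).card

theorem adjStat_cons (P : ℕ → Option ℕ → Prop) (x : ℕ) (l : List ℕ) :
    adjStat P (x :: l) = (if P x l.head? then 1 else 0) + adjStat P l := by
  simp only [adjStat, Finset.card_filter, List.length_cons, Finset.sum_range_succ']
  simp only [List.getD_cons_succ, List.getElem?_cons_succ, List.getD_cons_zero,
    List.head?_eq_getElem?]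
  exact add_comm _ _

theorem desList_eq_adjStat (l : List ℕ) : desList l = adjStat (fun x o => o.getD 0 < x) l := by
  simp only [desList, adjStat, List.getD_eq_getElem?_getD]

/-- The number of plateaus of a single word. -/
def platStat (l : List ℕ) : ℕ := adjStat (fun x o => o = some x) l

theorem cplat_eq_sum (c : List (List ℕ)) : cplat c = (c.map platStat).sum := by
  unfold cplat platStat adjStat
  congr 2
  ext w
  congr 1
  ext i
  simp only [Finset.mem_filter]
  refine and_congr_right fun _ => ?_
  by_cases h : i + 1 < w.length
  · simp [h, List.getD_eq_getElem?_getD, eq_comm]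
  · simp [h]

/-- Inserting the pair `m m` into a word with letters below `m` creates exactly one adjacency
of type `P`, and destroys the one that was present at the place of insertion. -/
structure CreatesOne (P : ℕ → Option ℕ → Prop) (m : ℕ) : Prop where
  not_left : ∀ x < m, ¬ P x (some m)
  sum_eq_one : ∀ o : Option ℕ, (∀ y ∈ o, y < m) →
    (if P m (some m) then 1 else 0) + (if P m o then 1 else 0) = 1

theorem createsOne_descent {m : ℕ} (hm : 0 < m) : CreatesOne (fun x o => o.getD 0 < x) m where
  not_left x hx := by simpa using hx.le
  sum_eq_one o ho := by
    cases o with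
    | none => simp [hm]
    | some y => simp [ho y rfl]

theorem createsOne_plateau (m : ℕ) : CreatesOne (fun x o => o = some x) m where
  not_left x hx := by simpa using hx.ne'
  sum_eq_one o ho := by
    have : o ≠ some m := fun h => (ho m h).false
    simp [this]

namespace CreatesOne

variable {P : ℕ → Option ℕ → Prop} {m : ℕ}

theorem adjStat_pair_cons (hP : CreatesOne P m) {l : List ℕ} (hl : ∀ v ∈ l, v < m) :
    adjStat P (m :: m :: l) = adjStat P l + 1 := by
  have := hP.sum_eq_one l.head? fun y hy => hl y (List.mem_of_mem_head? hy)
  rw [adjStat_cons, adjStat_cons, List.head?_cons]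
  omega

theorem adjStat_insertPair_succ (hP : CreatesOne P m) {l : List ℕ} (hl : ∀ v ∈ l, v < m)
    {i : ℕ} (hi : i < l.length) :
    adjStat P (insertPair m (i + 1) l) =
      adjStat P l + if P (l.getD i 0) l[i + 1]? then 0 else 1 := by
  induction l generalizing i with
  | nil => simp at hi
  | cons x l ih =>
    have hl' : ∀ v ∈ l, v < m := fun v hv => hl v (List.mem_cons_of_mem x hv)
    cases i with
    | zero =>
      rw [insertPair_succ_cons, insertPair_zero, adjStat_cons, hP.adjStat_pair_cons hl',
        adjStat_cons, List.head?_cons, if_neg (hP.not_left x (hl x (by simp)))]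
      simp only [List.getD_cons_zero, List.head?_eq_getElem?, List.getElem?_cons_succ]
      split_ifs <;> omega
    | succ i =>
      have hi' : i < l.length := by simpa using hi
      rw [insertPair_succ_cons, adjStat_cons, ih hl' hi', adjStat_cons]
      have : (insertPair m (i + 1) l).head? = l.head? := by
        cases l with
        | nil => simp at hi'
        | cons y t => rfl
      rw [this]
      simp only [List.getD_cons_succ, List.getElem?_cons_succ]
      omega

open Polynomial in
theorem sum_X_pow_insertPair (hP : CreatesOne P m) {l : List ℕ} (hl : ∀ v ∈ l, v < m) :
    ∑ i ∈ Finset.range l.length, (X : ℚ[X]) ^ adjStat P (insertPair m (i + 1) l) =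
      (adjStat P l : ℚ[X]) * X ^ adjStat P l +
        ((l.length : ℚ[X]) - (adjStat P l : ℚ[X])) * X ^ (adjStat P l + 1) := by
  set Q : ℕ → Prop := fun i => P (l.getD i 0) l[i + 1]?
  have h1 : ∀ i ∈ Finset.range l.length, (X : ℚ[X]) ^ adjStat P (insertPair m (i + 1) l) =
      if Q i then X ^ adjStat P l else X ^ (adjStat P l + 1) := by
    intro i hi
    rw [hP.adjStat_insertPair_succ hl (Finset.mem_range.1 hi)]
    split_ifs <;> rfl
  have h2 : ((Finset.range l.length).filter Q).card = adjStat P l := rfl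
  have h3 := Finset.card_filter_add_card_filter_not (s := Finset.range l.length) Q
  rw [h2, Finset.card_range] at h3
  rw [Finset.sum_congr rfl h1, Finset.sum_ite, Finset.sum_const, Finset.sum_const, h2,
    nsmul_eq_mul, nsmul_eq_mul]
  have h4 : (l.length : ℚ[X]) = adjStat P l + ((Finset.range l.length).filter (¬ Q ·)).card := by
    exact_mod_cast h3.symm
  rw [h4, add_sub_cancel_left]

end CreatesOne

/-! ### The recurrence -/

open Polynomial in
/-- The operator `x (1 - x) d/dx + (2n+1) x`, which takes the `n`-th generating polynomial
to the next one. -/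
def stirlingStep (n : ℕ) : ℚ[X] →ₗ[ℚ] ℚ[X] :=
  LinearMap.mulLeft ℚ (X - X ^ 2) ∘ₗ derivative +
    LinearMap.mulLeft ℚ (((2 * n + 1 : ℕ) : ℚ[X]) * X)

open Polynomial in
theorem stirlingStep_X_pow (n d : ℕ) :
    stirlingStep n (X ^ d) =
      (d : ℚ[X]) * X ^ d + (((2 * n + 1 : ℕ) : ℚ[X]) - (d : ℚ[X])) * X ^ (d + 1) := by
  cases d with
  | zero => simp [stirlingStep]
  | succ d =>
    simp only [stirlingStep, LinearMap.add_apply, LinearMap.comp_apply, LinearMap.mulLeft_apply,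
      derivative_X_pow, Nat.add_sub_cancel, map_natCast]
    ring

theorem insertPair_mem_stirlingPerms_iff {n : ℕ} {a b : List ℕ} (ha : ∀ v ∈ a, v < n + 1)
    (hb : ∀ v ∈ b, v < n + 1) :
    a ++ (n + 1) :: (n + 1) :: b ∈ stirlingPerms (n + 1) ↔ a ++ b ∈ stirlingPerms n := by
  rw [mem_stirlingPerms, mem_stirlingPerms, isStirlingWord_insert_iff ha hb, baseList_succ]
  refine and_congr_left fun _ => ?_
  have : (a ++ (n + 1) :: (n + 1) :: b).Perm ((a ++ b) ++ [n + 1, n + 1]) := by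
    simpa using (List.perm_append_comm (l₁ := [n + 1, n + 1]) (l₂ := b)).append_left a
  rw [this.congr_left, List.perm_append_right_iff]

theorem Cpoly_succ (n : ℕ) : Cpoly (n + 1) = stirlingStep n (Cpoly n) := by
  have hlt : ∀ l ∈ stirlingPerms n, ∀ v ∈ l, v < n + 1 := fun l hl v hv =>
    lt_of_mem_baseList ((mem_stirlingPerms.1 hl).1.subset hv)
  have hlen : ∀ l ∈ stirlingPerms n, l.length = 2 * n := fun l hl =>
    (mem_stirlingPerms.1 hl).1.length_eq.trans (length_baseList n)
  have key : Cpoly (n + 1) = ∑ p ∈ stirlingPerms n ×ˢ Finset.range (2 * n + 1),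
      Polynomial.X ^ desList (insertPair (n + 1) p.2 p.1) := by
    symm
    refine Finset.sum_nbij (fun p => insertPair (n + 1) p.2 p.1) ?_ ?_ ?_ fun _ _ => rfl
    · rintro ⟨l, i⟩ h
      have hl := (Finset.mem_product.1 h).1
      refine (insertPair_mem_stirlingPerms_iff
        (fun v hv => hlt l hl v (List.mem_of_mem_take hv))
        fun v hv => hlt l hl v (List.mem_of_mem_drop hv)).2 ?_
      rwa [List.take_append_drop]
    · rintro ⟨l, i⟩ h ⟨l', j⟩ h' e
      simp only [Finset.coe_product, Set.mem_prod, Finset.mem_coe, Finset.mem_range] at h h' e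
      have hm : n + 1 ∉ l := fun hv => (hlt l h.1 _ hv).false
      have hm' : n + 1 ∉ l' := fun hv => (hlt l' h'.1 _ hv).false
      have hll : l = l' := by rw [← filter_insertPair hm i, e, filter_insertPair hm' j]
      subst hll
      have := hlen l h.1
      rw [insertPair_left_inj hm (by omega) (by omega) e]
    · intro τ hτ
      have hτ' := mem_stirlingPerms.1 hτ
      obtain ⟨a, b, rfl, ha, hb⟩ := hτ'.2.exists_eq_insert (m := n + 1)
        (by
          have : n + 1 ∉ baseList n := fun h => (lt_of_mem_baseList h).false
          simp [hτ'.1.count_eq, baseList_succ, List.count_eq_zero.2 this])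
        (fun v hv => by
          have := lt_of_mem_baseList (hτ'.1.subset hv)
          omega)
      have hab := (insertPair_mem_stirlingPerms_iff ha hb).1 hτ
      have := hlen _ hab
      rw [List.length_append] at this
      exact ⟨(a ++ b, a.length), by simp [hab]; omega, insertPair_append _ _ _⟩
  rw [key, Finset.sum_product, Cpoly, map_sum]
  refine Finset.sum_congr rfl fun l hl => ?_
  have hP := createsOne_descent n.succ_pos
  have h := hP.sum_X_pow_insertPair (hlt l hl)
  rw [Finset.sum_range_succ', stirlingStep_X_pow]
  simp only [desList_eq_adjStat, insertPair_zero, hP.adjStat_pair_cons (hlt l hl)]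
  rw [hlen l hl] at h
  rw [h]
  push_cast
  ring

/-! ### Insertion into a list of cycles -/

/-- Insert the pair `m m` right after the `p`-th letter (counted from `0`) of the cycles `c`, or
as a new last cycle when `c` has only `p` letters. -/
def insertCycle (m : ℕ) : List (List ℕ) → ℕ → List (List ℕ)
  | [], _ => [[m, m]]
  | w :: c, p => if p < w.length then insertPair m (p + 1) w :: c
      else w :: insertCycle m c (p - w.length)

theorem insertCycle_flatten_length_append (m : ℕ) (c₁ c₂ : List (List ℕ)) (p : ℕ) :
    insertCycle m (c₁ ++ c₂) (c₁.flatten.length + p) = c₁ ++ insertCycle m c₂ p := by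
  induction c₁ with
  | nil => simp
  | cons w c₁ ih =>
    have h : (w :: c₁).flatten.length + p - w.length = c₁.flatten.length + p := by
      simp only [List.flatten_cons, List.length_append]; omega
    rw [List.cons_append, insertCycle, if_neg, h, ih, List.cons_append]
    simp only [List.flatten_cons, List.length_append]; omega

/-- The two shapes of the insertion of a pair. -/
theorem insertCycle_cases (m : ℕ) {c : List (List ℕ)} {p : ℕ} (hp : p ≤ c.flatten.length) :
    insertCycle m c p = c ++ [[m, m]] ∨
      ∃ c₁ a b c₂, a ≠ [] ∧ c = c₁ ++ (a ++ b) :: c₂ ∧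
        insertCycle m c p = c₁ ++ (a ++ m :: m :: b) :: c₂ := by
  induction c generalizing p with
  | nil => exact Or.inl rfl
  | cons w c ih =>
    rw [List.flatten_cons, List.length_append] at hp
    rw [insertCycle]
    split_ifs with h
    · refine Or.inr ⟨[], w.take (p + 1), w.drop (p + 1), c, ?_, by simp, rfl⟩
      rw [ne_eq, ← List.length_eq_zero_iff, List.length_take]
      omega
    · rcases ih (p := p - w.length)
        (by omega) with e | e
      · exact Or.inl (by rw [e, List.cons_append])
      · obtain ⟨c₁, a, b, c₂, ha, e₁, e₂⟩ := e
        exact Or.inr ⟨w :: c₁, a, b, c₂, ha, by rw [e₁, List.cons_append],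
          by rw [e₂, List.cons_append]⟩

theorem filter_insertCycle {m : ℕ} {c : List (List ℕ)} (hc : ∀ w ∈ c, w ≠ [] ∧ m ∉ w) (p : ℕ) :
    ((insertCycle m c p).map (List.filter fun z => z != m)).filter
      (fun w => !w.isEmpty) = c := by
  have hself : ∀ w : List ℕ, m ∉ w → w.filter (fun z => z != m) = w := fun w hw =>
    List.filter_eq_self.2 fun z hz => by simpa using fun e : z = m => hw (e ▸ hz)
  have hall : ∀ c : List (List ℕ), (∀ w ∈ c, w ≠ [] ∧ m ∉ w) →
      (c.map (List.filter fun z => z != m)).filter (fun w => !w.isEmpty) = c := by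
    intro c hc
    rw [List.map_congr_left (g := id) fun w hw => hself w (hc w hw).2, List.map_id]
    exact List.filter_eq_self.2 fun w hw => by simpa using (hc w hw).1
  induction c generalizing p with
  | nil => simp [insertCycle]
  | cons w c ih =>
    have hw := hc w List.mem_cons_self
    have hc' : ∀ w ∈ c, w ≠ [] ∧ m ∉ w := fun v hv => hc v (List.mem_cons_of_mem w hv)
    rw [insertCycle]
    split_ifs with h
    · rw [List.map_cons, filter_insertPair hw.2, List.filter_cons_of_pos (by simpa using hw.1),
        hall c hc']
    · rw [List.map_cons, hself w hw.2, List.filter_cons_of_pos (by simpa using hw.1), ih hc']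

theorem insertCycle_right_inj {m : ℕ} {c : List (List ℕ)} (hc : ∀ w ∈ c, m ∉ w) {p q : ℕ}
    (hp : p ≤ c.flatten.length) (hq : q ≤ c.flatten.length)
    (e : insertCycle m c p = insertCycle m c q) : p = q := by
  induction c generalizing p q with
  | nil => simp at hp hq; omega
  | cons w c ih =>
    have hw := hc w List.mem_cons_self
    simp only [List.flatten_cons, List.length_append] at hp hq
    rw [insertCycle, insertCycle] at e
    split_ifs at e with h₁ h₂ h₂ <;> rw [List.cons.injEq] at e
    · have := insertPair_left_inj hw (by omega) (by omega) e.1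
      omega
    · exact absurd (e.1 ▸ mem_insertPair_self m (p + 1) w) hw
    · exact absurd (e.1 ▸ mem_insertPair_self m (q + 1) w) hw
    · have := ih (fun v hv => hc v (List.mem_cons_of_mem w hv)) (by omega) (by omega) e.2
      omega

open Polynomial in
theorem sum_X_pow_cplat_insertCycle {m : ℕ} {c : List (List ℕ)} (hc : ∀ w ∈ c, ∀ v ∈ w, v < m) :
    ∑ p ∈ Finset.range (c.flatten.length + 1), (X : ℚ[X]) ^ cplat (insertCycle m c p) =
      (cplat c : ℚ[X]) * X ^ cplat c +
        (((c.flatten.length + 1 : ℕ) : ℚ[X]) - (cplat c : ℚ[X])) * X ^ (cplat c + 1) := by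
  have hP := createsOne_plateau m
  simp only [cplat_eq_sum]
  induction c with
  | nil =>
    have : platStat [m, m] = 1 := hP.adjStat_pair_cons (l := []) (by simp)
    simp [insertCycle, this]
  | cons w c ih =>
    have hw := hP.sum_X_pow_insertPair (hc w List.mem_cons_self)
    have ih := ih fun v hv => hc v (List.mem_cons_of_mem w hv)
    rw [List.flatten_cons, List.length_append, add_assoc, Finset.sum_range_add]
    have e₁ : ∀ p ∈ Finset.range w.length,
        (X : ℚ[X]) ^ ((insertCycle m (w :: c) p).map platStat).sum =
          X ^ platStat (insertPair m (p + 1) w) * X ^ (c.map platStat).sum := by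
      intro p hp
      rw [insertCycle, if_pos (Finset.mem_range.1 hp), List.map_cons, List.sum_cons, pow_add]
    have e₂ : ∀ p ∈ Finset.range (c.flatten.length + 1),
        (X : ℚ[X]) ^ ((insertCycle m (w :: c) (w.length + p)).map platStat).sum =
          X ^ platStat w * X ^ ((insertCycle m c p).map platStat).sum := by
      intro p _
      rw [insertCycle, if_neg (by omega), Nat.add_sub_cancel_left, List.map_cons, List.sum_cons,
        pow_add]
    rw [Finset.sum_congr rfl e₁, Finset.sum_congr rfl e₂, ← Finset.sum_mul, ← Finset.mul_sum, ih]
    change ∑ i ∈ Finset.range w.length, (X : ℚ[X]) ^ platStat (insertPair m (i + 1) w) =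
      (platStat w : ℚ[X]) * X ^ platStat w +
        ((w.length : ℚ[X]) - (platStat w : ℚ[X])) * X ^ (platStat w + 1) at hw
    rw [hw, List.map_cons, List.sum_cons]
    push_cast
    ring

theorem IsStirling2.lt {n : ℕ} {c : List (List ℕ)} (h : IsStirling2 n c) {w : List ℕ}
    (hw : w ∈ c) {v : ℕ} (hv : v ∈ w) : v < n + 1 :=
  lt_of_mem_baseList (h.1.subset (List.mem_flatten.2 ⟨w, hw, hv⟩))

theorem headI_mem_of_ne_nil {w : List ℕ} (hw : w ≠ []) : w.headI ∈ w := by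
  cases w with
  | nil => exact absurd rfl hw
  | cons x t => exact List.mem_cons_self

theorem isChain_headI_iff {c : List (List ℕ)} :
    c.IsChain (fun w₁ w₂ => w₁.headI < w₂.headI) ↔ (c.map List.headI).IsChain (· < ·) := by
  rw [List.isChain_map]

theorem IsStirling2.append_pair {n : ℕ} {c : List (List ℕ)} (h : IsStirling2 n c) :
    IsStirling2 (n + 1) (c ++ [[n + 1, n + 1]]) := by
  refine ⟨?_, ?_, ?_⟩
  · rw [baseList_succ, List.flatten_append]
    exact h.1.append_right _
  · intro w hw
    rcases List.mem_append.1 hw with hw | hw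
    · exact h.2.1 w hw
    · rw [List.mem_singleton] at hw
      subst hw
      refine ⟨by simp, by simp, by simp, ?_⟩
      exact (isStirlingWord_insert_iff (a := []) (b := []) (by simp) (by simp)).2
        (isStirlingWord_iff_sublist.2 (by simp))
  · refine List.isChain_append.2 ⟨h.2.2, by simp, fun w hw v hv => ?_⟩
    have hw' := List.mem_of_mem_getLast? hw
    simp only [List.head?_cons, Option.mem_def, Option.some.injEq] at hv
    subst hv
    exact h.lt hw' (headI_mem_of_ne_nil (h.2.1 w hw').1)

theorem IsStirling2.of_append_pair {n : ℕ} {c : List (List ℕ)}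
    (h : IsStirling2 (n + 1) (c ++ [[n + 1, n + 1]])) : IsStirling2 n c := by
  refine ⟨?_, fun w hw => h.2.1 w (List.mem_append_left _ hw), (List.isChain_append.1 h.2.2).1⟩
  have := h.1
  rw [baseList_succ, List.flatten_append] at this
  exact (List.perm_append_right_iff _).1 this

theorem isStirling2_insert_iff {n : ℕ} {a b : List ℕ} (c₁ c₂ : List (List ℕ)) (hne : a ≠ [])
    (ha : ∀ v ∈ a, v < n + 1) (hb : ∀ v ∈ b, v < n + 1) :
    IsStirling2 (n + 1) (c₁ ++ (a ++ (n + 1) :: (n + 1) :: b) :: c₂) ↔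
      IsStirling2 n (c₁ ++ (a ++ b) :: c₂) := by
  obtain ⟨x, a, rfl⟩ := List.exists_cons_of_ne_nil hne
  have hx : x < n + 1 := ha x List.mem_cons_self
  have hma : n + 1 ∉ x :: a := fun h => (ha _ h).false
  have hmb : n + 1 ∉ b := fun h => (hb _ h).false
  unfold IsStirling2
  refine and_congr ?_ (and_congr ?_ ?_)
  · have hperm : (c₁ ++ (x :: a ++ (n + 1) :: (n + 1) :: b) :: c₂).flatten.Perm
        ((c₁ ++ (x :: a ++ b) :: c₂).flatten ++ [n + 1, n + 1]) := by
      rw [List.perm_iff_count]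
      intro v
      simp only [List.flatten_append, List.flatten_cons, List.count_append, List.count_cons,
        List.count_nil]
      omega
    rw [baseList_succ, hperm.congr_left, List.perm_append_right_iff]
  · have hcount : (∀ v ∈ x :: a ++ (n + 1) :: (n + 1) :: b,
          (x :: a ++ (n + 1) :: (n + 1) :: b).count v = 2) ↔
        ∀ v ∈ x :: a ++ b, (x :: a ++ b).count v = 2 := by
      have hself : (x :: a ++ (n + 1) :: (n + 1) :: b).count (n + 1) = 2 := by
        rw [List.count_append, List.count_eq_zero.2 hma, List.count_cons_self,
          List.count_cons_self, List.count_eq_zero.2 hmb]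
      have hother : ∀ v ≠ n + 1,
          (x :: a ++ (n + 1) :: (n + 1) :: b).count v = (x :: a ++ b).count v := by
        intro v hv
        rw [List.count_append, List.count_append, List.count_cons_of_ne hv.symm,
          List.count_cons_of_ne hv.symm]
      constructor
      · intro h v hv
        have hvm : v ≠ n + 1 := by
          rintro rfl
          exact (List.mem_append.1 hv).elim hma hmb
        rw [← hother v hvm]
        refine h v ?_
        rw [List.mem_append] at hv ⊢
        exact hv.imp_right fun hv => List.mem_cons_of_mem _ (List.mem_cons_of_mem _ hv)
      · intro h v hv
        by_cases hvm : v = n + 1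
        · rw [hvm, hself]
        · rw [hother v hvm]
          refine h v ?_
          simpa only [List.mem_append, List.mem_cons, hvm, false_or] using hv
    have hhead : (∀ v ∈ x :: a ++ (n + 1) :: (n + 1) :: b,
          (x :: a ++ (n + 1) :: (n + 1) :: b).headI ≤ v) ↔
        ∀ v ∈ x :: a ++ b, (x :: a ++ b).headI ≤ v := by
      simp only [List.forall_mem_append, List.forall_mem_cons, List.cons_append, List.headI_cons,
        hx.le, true_and]
    rw [List.forall_mem_append, List.forall_mem_append, List.forall_mem_cons, List.forall_mem_cons,
      hcount, hhead, isStirlingWord_insert_iff ha hb]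
    simp only [List.cons_append, ne_eq, reduceCtorEq, not_false_eq_true]
  · refine isChain_headI_iff.trans (Iff.trans ?_ isChain_headI_iff.symm)
    simp

theorem IsStirling2.exists_insertCycle {n : ℕ} {τ : List (List ℕ)} (h : IsStirling2 (n + 1) τ) :
    ∃ c p, IsStirling2 n c ∧ p ≤ c.flatten.length ∧ insertCycle (n + 1) c p = τ := by
  have hm : n + 1 ∈ τ.flatten := h.1.symm.subset (by simp [baseList_succ])
  obtain ⟨w, hw, hmw⟩ := List.mem_flatten.1 hm
  obtain ⟨c₁, c₂, rfl⟩ := List.append_of_mem hw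
  obtain ⟨hne, hcount, hhead, hst⟩ := h.2.1 w hw
  obtain ⟨a, b, rfl, ha, hb⟩ := hst.exists_eq_insert (hcount _ hmw)
    fun v hv => Nat.le_of_lt_succ (h.lt hw hv)
  by_cases hnil : a = []
  · subst hnil
    have hbnil : b = [] := by
      refine List.eq_nil_iff_forall_not_mem.2 fun v hv => ?_
      have h₁ := hb v hv
      have h₂ := hhead v (by simp [hv])
      simp at h₂
      omega
    subst hbnil
    have hc₂ : c₂ = [] := by
      cases c₂ with
      | nil => rfl
      | cons w' c₂ =>
        have hlt : n + 1 < w'.headI :=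
          (List.isChain_cons_cons.1 (List.isChain_append.1 h.2.2).2.1).1
        have hw' : w' ∈ c₁ ++ ([] ++ [n + 1, n + 1]) :: w' :: c₂ := by simp
        have := h.lt hw' (headI_mem_of_ne_nil (h.2.1 w' hw').1)
        omega
    subst hc₂
    refine ⟨c₁, c₁.flatten.length, h.of_append_pair, le_rfl, ?_⟩
    simpa [insertCycle] using insertCycle_flatten_length_append (n + 1) c₁ [] 0
  · have hpos := List.length_pos_iff.2 hnil
    refine ⟨c₁ ++ (a ++ b) :: c₂, c₁.flatten.length + (a.length - 1),
      (isStirling2_insert_iff c₁ c₂ hnil ha hb).1 h, ?_, ?_⟩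
    · simp only [List.flatten_append, List.flatten_cons, List.length_append]
      omega
    · rw [insertCycle_flatten_length_append, insertCycle,
        if_pos (by rw [List.length_append]; omega), Nat.sub_add_cancel hpos, insertPair_append]

theorem IsStirling2.insertCycle {n : ℕ} {c : List (List ℕ)} (h : IsStirling2 n c) {p : ℕ}
    (hp : p ≤ c.flatten.length) : IsStirling2 (n + 1) (insertCycle (n + 1) c p) := by
  rcases insertCycle_cases (n + 1) hp with e | ⟨c₁, a, b, c₂, hne, rfl, e⟩
  · rw [e]
    exact h.append_pair
  · have hab : a ++ b ∈ c₁ ++ (a ++ b) :: c₂ := by simp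
    rw [e, isStirling2_insert_iff c₁ c₂ hne (fun v hv => h.lt hab (by simp [hv]))
      fun v hv => h.lt hab (by simp [hv])]
    exact h

theorem sum_stirling2_succ (n : ℕ) :
    ∑ σ ∈ stirling2 (n + 1), (Polynomial.X : Polynomial ℚ) ^ cplat σ =
      stirlingStep n (∑ σ ∈ stirling2 n, Polynomial.X ^ cplat σ) := by
  have hlen : ∀ c ∈ stirling2 n, c.flatten.length = 2 * n := fun c hc =>
    (mem_stirling2.1 hc).1.length_eq.trans (length_baseList n)
  have hlt : ∀ c ∈ stirling2 n, ∀ w ∈ c, ∀ v ∈ w, v < n + 1 := fun c hc w hw v hv =>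
    (mem_stirling2.1 hc).lt hw hv
  have hnot : ∀ c ∈ stirling2 n, ∀ w ∈ c, n + 1 ∉ w := fun c hc w hw hv =>
    (hlt c hc w hw _ hv).false
  have key : ∑ σ ∈ stirling2 (n + 1), (Polynomial.X : Polynomial ℚ) ^ cplat σ =
      ∑ q ∈ stirling2 n ×ˢ Finset.range (2 * n + 1),
        Polynomial.X ^ cplat (insertCycle (n + 1) q.1 q.2) := by
    symm
    refine Finset.sum_nbij (fun q => insertCycle (n + 1) q.1 q.2) ?_ ?_ ?_ fun _ _ => rfl
    · rintro ⟨c, p⟩ h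
      simp only [Finset.mem_product, Finset.mem_range] at h
      have := hlen c h.1
      exact mem_stirling2.2 ((mem_stirling2.1 h.1).insertCycle (by omega))
    · rintro ⟨c, p⟩ h ⟨c', q⟩ h' e
      simp only [Finset.coe_product, Set.mem_prod, Finset.mem_coe, Finset.mem_range] at h h' e
      have hc : ∀ c ∈ stirling2 n, ∀ w ∈ c, w ≠ [] ∧ n + 1 ∉ w := fun c hc w hw =>
        ⟨((mem_stirling2.1 hc).2.1 w hw).1, hnot c hc w hw⟩
      have hcc : c = c' := by
        rw [← filter_insertCycle (hc c h.1) p, e, filter_insertCycle (hc c' h'.1) q]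
      subst hcc
      have := hlen c h.1
      rw [insertCycle_right_inj (hnot c h.1) (by omega) (by omega) e]
    · intro τ hτ
      obtain ⟨c, p, hc, hp, e⟩ := (mem_stirling2.1 hτ).exists_insertCycle
      have hc' := mem_stirling2.2 hc
      have := hlen c hc'
      exact ⟨(c, p), by simp [hc']; omega, e⟩
  rw [key, Finset.sum_product, map_sum]
  refine Finset.sum_congr rfl fun c hc => ?_
  rw [stirlingStep_X_pow, ← hlen c hc, sum_X_pow_cplat_insertCycle (hlt c hc)]

theorem Cpoly_zero : Cpoly 0 = 1 := by
  have : stirlingPerms 0 = {[]} := by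
    ext l
    rw [mem_stirlingPerms, Finset.mem_singleton]
    simp only [baseList, List.range_zero, List.flatMap_nil, List.perm_nil, and_iff_left_iff_imp]
    rintro rfl
    exact isStirlingWord_iff_sublist.2 (by simp)
  simp [Cpoly, this, desList]

theorem sum_stirling2_zero :
    ∑ σ ∈ stirling2 0, (Polynomial.X : Polynomial ℚ) ^ cplat σ = 1 := by
  have : stirling2 0 = {[]} := by
    ext c
    rw [mem_stirling2, Finset.mem_singleton]
    constructor
    · intro h
      refine List.eq_nil_iff_forall_not_mem.2 fun w hw => ?_
      have := h.1.subset (List.mem_flatten.2 ⟨w, hw, headI_mem_of_ne_nil (h.2.1 w hw).1⟩)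
      rw [show baseList 0 = [] from rfl] at this
      exact absurd this List.not_mem_nil
    · rintro rfl
      exact ⟨by simp [baseList], by simp, List.isChain_nil⟩
  simp [this, cplat]

/-- For `n ≥ 1`:  `C_n(x) = ∑_{π ∈ Q_n²} x^{cplat(π)}`; i.e. for each `k` the number of
Stirling permutations of the second kind of order `n` with `k` cycle plateaus equals the
number of Stirling permutations of order `n` with `k` descents. -/
theorem stmt4 (n : ℕ) (hn : 1 ≤ n) :
    Cpoly n = ∑ σ ∈ stirling2 n, Polynomial.X ^ cplat σ := by
  clear hn
  induction n with
  | zero => rw [Cpoly_zero, sum_stirling2_zero]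
  | succ n ih => rw [Cpoly_succ, sum_stirling2_succ, ih]
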